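/- arXiv:1408.4289 — 8 statements merged into one kernel-verified Lean document; each statement's English description precedes it below -/
import Mathlib

section
/- Let F(x,y,z) = (f(x) − ε(x,y,z), x, δ(x,y,z)) be a three-dimensional Hénon-like map on the box B = Iˣ × Iʸ × Iᶻ, and let H(x,y,z) = (f(x) − ε(x,y,z), y, z − δ(y, g(y), 0)) be the horizontal-like diffeomorphism, where g is a local inverse of f with f(g(y)) = y on Iʸ and g(f(x)) = x on the relevant interval. Suppose ‖ε‖_{C²} ≤ ε̄ and ‖δ‖_{C²} ≤ δ̄, that H is injective on a region Ω ⊆ B with H(Ω) = V × Iʸ × Iᶻ for an interval V ⊆ Iˣ, and that F(Ω) and F²(Ω) are contained in B. Define f₁(x) = f(f(x)) − ε(f(x),x,0) − [f'(f(x)) − ∂ₓε(f(x),x,0)]·ε(x,g(x),0). Then for every w = (x,y,z) ∈ V × Iʸ × Iᶻ one has H∘F²∘H⁻¹(w) = (f₁(x) − ε₁(w), x, δ₁(w)) for functions ε₁, δ₁ (defined by this equation), and there exist a constant C > 0, depending only on ‖f‖_{C²}, ‖g‖_{C¹} and the diameter of B, and a threshold ε̄₀ > 0 such that whenever ε̄,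 δ̄ ≤ ε̄₀: ‖f₁ − f∘f‖_{C⁰(V)} ≤ C ε̄, ‖ε₁‖_{C⁰} ≤ C(ε̄² + ε̄ δ̄), and ‖δ₁‖_{C⁰} ≤ C(ε̄ δ̄ + δ̄²). In particular the second coordinate of H∘F²∘H⁻¹(x,y,z) is exactly x. -/
/-- The three-dimensional Hénon-like map `F(x,y,z) = (f(x) − ε(x,y,z), x, δ(x,y,z))`. -/
def henonMap (f : ℝ → ℝ) (ε δ : ℝ × ℝ × ℝ → ℝ) (w : ℝ × ℝ × ℝ) : ℝ × ℝ × ℝ :=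
  (f w.1 - ε w, w.1, δ w)

/-- The horizontal-like diffeomorphism
`H(x,y,z) = (f(x) − ε(x,y,z), y, z − δ(y, g(y), 0))`, where `g` is a local inverse
of `f`. -/
def horizMap (f g : ℝ → ℝ) (ε δ : ℝ × ℝ × ℝ → ℝ) (w : ℝ × ℝ × ℝ) : ℝ × ℝ × ℝ :=
  (f w.1 - ε w, w.2.1, w.2.2 - δ (w.2.1, g w.2.1, 0))

/-- The one-dimensional part of the pre-renormalization:
`f₁(x) = f(f(x)) − ε(f(x),x,0) − [f'(f(x)) − ∂ₓε(f(x),x,0)]·ε(x,g(x),0)`. -/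
noncomputable def fOne (f g : ℝ → ℝ) (ε : ℝ × ℝ × ℝ → ℝ) (x : ℝ) : ℝ :=
  f (f x) - ε (f x, x, 0) -
    (deriv f (f x) - fderiv ℝ ε (f x, x, 0) (1, 0, 0)) * ε (x, g x, 0)

theorem aux_lip {E : Type*} [NormedAddCommGroup E] [NormedSpace ℝ E] (h : E → ℝ) (b : ℝ)
    (hc : ContDiff ℝ 2 h) (hb : ∀ i : ℕ, i ≤ 2 → ∀ w, ‖iteratedFDeriv ℝ i h w‖ ≤ b) (p q : E) :
    |h p - h q| ≤ b * ‖p - q‖ := by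
  have h1 : ∀ w, ‖fderiv ℝ h w‖ ≤ b := fun w => by
    rw [← norm_iteratedFDeriv_one]; exact hb 1 (by norm_num) w
  have := Convex.norm_image_sub_le_of_norm_fderiv_le (𝕜 := ℝ) (f := h) (s := Set.univ) (C := b)
    (x := q) (y := p)
    (fun x _ => (hc.differentiable (by norm_num)) x) (fun x _ => h1 x) convex_univ trivial trivial
  simpa [Real.norm_eq_abs] using this

theorem aux_lip1 (h : ℝ → ℝ) (b : ℝ)
    (hc : Differentiable ℝ h) (hb : ∀ w, |deriv h w| ≤ b) (p q : ℝ) :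
    |h p - h q| ≤ b * |p - q| := by
  have := Convex.norm_image_sub_le_of_norm_deriv_le (𝕜 := ℝ) (f := h) (s := Set.univ) (C := b)
    (x := q) (y := p)
    (fun x _ => hc x) (fun x _ => hb x) convex_univ trivial trivial
  simpa [Real.norm_eq_abs] using this

theorem aux_taylor (f : ℝ → ℝ) (M : ℝ) (hc : ContDiff ℝ 2 f)
    (hb : ∀ x, |deriv (deriv f) x| ≤ M) (X u : ℝ) :
    |f X - f u - deriv f u * (X - u)| ≤ M * |X - u| ^ 2 := by
  have hM : 0 ≤ M := (abs_nonneg _).trans (hb 0)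
  have hd : Differentiable ℝ f := hc.differentiable (by norm_num)
  have hd' : Differentiable ℝ (deriv f) := by
    have : ContDiff ℝ 1 (deriv f) := ContDiff.deriv' (n := 1) (by rw [one_add_one_eq_two]; exact hc)
    exact this.differentiable (by norm_num)
  have hder : ∀ t, HasDerivAt (fun t => f t - deriv f u * t) (deriv f t - deriv f u) t := fun t => by
    have h1 := (hd t).hasDerivAt.sub ((hasDerivAt_id t).const_mul (deriv f u))
    rw [mul_one] at h1
    exact h1
  have := Convex.norm_image_sub_le_of_norm_hasDerivWithin_le (𝕜 := ℝ)
    (f := fun t => f t - deriv f u * t) (f' := fun t => deriv f t - deriv f u)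
    (s := Set.uIcc u X) (C := M * |X - u|) (x := u) (y := X)
    (fun x _ => (hder x).hasDerivWithinAt)
    (fun x hx => by
      refine (aux_lip1 (deriv f) M hd' hb x u).trans ?_
      exact mul_le_mul_of_nonneg_left (Set.abs_sub_left_of_mem_uIcc hx) hM)
    (convex_uIcc u X) Set.left_mem_uIcc Set.right_mem_uIcc
  simp only [Real.norm_eq_abs] at this
  calc _ = |f X - deriv f u * X - (f u - deriv f u * u)| := by congr 1; ring
    _ ≤ _ := this
    _ = _ := by ring

/-- Pre-renormalization of a three-dimensional Hénon-like map: there are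
constants `C > 0` and `ε̄₀ > 0`, depending only on the `C²` norm of `f`, the `C¹` norm of
`g` and the diameter of the box `B = Iˣ × Iʸ × Iᶻ`, such that whenever
`‖ε‖_{C²} ≤ ε̄ ≤ ε̄₀` and `‖δ‖_{C²} ≤ δ̄ ≤ ε̄₀`, the map `H∘F²∘H⁻¹` is again a
Hénon-like map `(x,y,z) ↦ (f₁(x) − ε₁(x,y,z), x, δ₁(x,y,z))` on `V × Iʸ × Iᶻ` (in
particular its second coordinate is exactly `x`), with `‖f₁ − f∘f‖_{C⁰(V)} ≤ C ε̄`,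
`‖ε₁‖_{C⁰} ≤ C(ε̄² + ε̄ δ̄)` and `‖δ₁‖_{C⁰} ≤ C(ε̄ δ̄ + δ̄²)`. -/
theorem stmt_0 (Mf Mg R : ℝ) :
    ∃ C : ℝ, 0 < C ∧ ∃ ε₀ : ℝ, 0 < ε₀ ∧
      ∀ (f g : ℝ → ℝ) (ε δ : ℝ × ℝ × ℝ → ℝ) (εb δb : ℝ)
        (Ix Iy Iz V : Set ℝ) (Ω : Set (ℝ × ℝ × ℝ)) (Hinv : ℝ × ℝ × ℝ → ℝ × ℝ × ℝ),
        -- regularity and norm bounds on `f` and `g`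
        ContDiff ℝ 2 f →
        (∀ x : ℝ, |f x| ≤ Mf) → (∀ x : ℝ, |deriv f x| ≤ Mf) →
        (∀ x : ℝ, |deriv (deriv f) x| ≤ Mf) →
        ContDiff ℝ 1 g →
        (∀ x : ℝ, |g x| ≤ Mg) → (∀ x : ℝ, |deriv g x| ≤ Mg) →
        -- regularity and `C²` bounds on the perturbations `ε` and `δ`
        ContDiff ℝ 2 ε → ContDiff ℝ 2 δ →
        0 ≤ εb → 0 ≤ δb → εb ≤ ε₀ → δb ≤ ε₀ →
        (∀ i : ℕ, i ≤ 2 → ∀ w : ℝ × ℝ × ℝ, ‖iteratedFDeriv ℝ i ε w‖ ≤ εb) →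
        (∀ i : ℕ, i ≤ 2 → ∀ w : ℝ × ℝ × ℝ, ‖iteratedFDeriv ℝ i δ w‖ ≤ δb) →
        -- `g` is a local inverse of `f`
        (∀ y ∈ Iy, f (g y) = y) →
        (∀ w ∈ Ω, g (f w.1) = w.1) →
        -- geometry of the box, the domain `Ω` of `H`, and `V`
        Metric.diam (Ix ×ˢ Iy ×ˢ Iz : Set (ℝ × ℝ × ℝ)) ≤ R →
        V ⊆ Ix →
        Ω ⊆ Ix ×ˢ Iy ×ˢ Iz →
        Set.InjOn (horizMap f g ε δ) Ω →
        horizMap f g ε δ '' Ω = V ×ˢ Iy ×ˢ Iz →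
        henonMap f ε δ '' Ω ⊆ Ix ×ˢ Iy ×ˢ Iz →
        henonMap f ε δ '' (henonMap f ε δ '' Ω) ⊆ Ix ×ˢ Iy ×ˢ Iz →
        -- `Hinv` inverts `H` on `H(Ω) = V × Iʸ × Iᶻ`
        (∀ w ∈ V ×ˢ Iy ×ˢ Iz, Hinv w ∈ Ω ∧ horizMap f g ε δ (Hinv w) = w) →
        -- conclusion
        (∃ ε₁ δ₁ : ℝ × ℝ × ℝ → ℝ,
          (∀ w ∈ V ×ˢ Iy ×ˢ Iz,
            horizMap f g ε δ (henonMap f ε δ (henonMap f ε δ (Hinv w))) =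
              (fOne f g ε w.1 - ε₁ w, w.1, δ₁ w)) ∧
          (∀ w ∈ V ×ˢ Iy ×ˢ Iz, |ε₁ w| ≤ C * (εb ^ 2 + εb * δb)) ∧
          (∀ w ∈ V ×ˢ Iy ×ˢ Iz, |δ₁ w| ≤ C * (εb * δb + δb ^ 2))) ∧
        (∀ x ∈ V, |fOne f g ε x - f (f x)| ≤ C * εb) := by
  set A := |Mf| with hA
  set G := |Mg| with hG
  have hA0 : 0 ≤ A := abs_nonneg _
  have hG0 : 0 ≤ G := abs_nonneg _
  refine ⟨10 * (1 + A) * (1 + G), by positivity, 1, one_pos, ?_⟩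
  intro f g ε δ e d Ix Iy Iz V Ω Hinv hf hf0 hf1 hf2 hg hg0 hg1 hε hδ he0 hd0 he hd hεb hδb
    hfg hgf _ _ _ _ _ _ _ hH
  replace hf1 : ∀ x, |deriv f x| ≤ A := fun x => (hf1 x).trans (le_abs_self _)
  replace hf2 : ∀ x, |deriv (deriv f) x| ≤ A := fun x => (hf2 x).trans (le_abs_self _)
  replace hg1 : ∀ x, |deriv g x| ≤ G := fun x => (hg1 x).trans (le_abs_self _)
  have hE0 : ∀ w, |ε w| ≤ e := fun w => by simpa using hεb 0 (by norm_num) w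
  have hD0 : ∀ w, |δ w| ≤ d := fun w => by simpa using hδb 0 (by norm_num) w
  have hE1 : ∀ w, |fderiv ℝ ε w (1, 0, 0)| ≤ e := fun w => by
    have h1 := (fderiv ℝ ε w).le_opNorm (1, 0, 0)
    have h2 : ‖fderiv ℝ ε w‖ ≤ e := by
      rw [← norm_iteratedFDeriv_one]; exact hεb 1 (by norm_num) w
    have h3 : ‖((1 : ℝ), (0 : ℝ), (0 : ℝ))‖ = 1 := by simp [Prod.norm_def]
    rw [h3, mul_one] at h1
    exact h1.trans h2
  have hGd : Differentiable ℝ g := hg.differentiable (by norm_num)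
  -- key estimate on the preimage
  have key : ∀ w ∈ V ×ˢ Iy ×ˢ Iz, f (Hinv w).1 - ε (Hinv w) = w.1 ∧
      ‖((w.1, (Hinv w).1, δ (Hinv w)) : ℝ × ℝ × ℝ) - (w.1, g w.1, 0)‖ ≤ G * e + d := by
    intro w hw
    obtain ⟨h1, h2⟩ := hH w hw
    have h3 : f (Hinv w).1 - ε (Hinv w) = w.1 := congrArg Prod.fst h2
    refine ⟨h3, ?_⟩
    have h4 : |(Hinv w).1 - g w.1| ≤ G * e := by
      have := aux_lip1 g G hGd hg1 (f (Hinv w).1) w.1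
      rw [hgf _ h1] at this
      refine this.trans (mul_le_mul_of_nonneg_left ?_ hG0)
      rw [← h3]; simpa using hE0 (Hinv w)
    have h5 := hD0 (Hinv w)
    have : 0 ≤ G * e := by positivity
    simp only [Prod.norm_def, Prod.mk_sub_mk, Real.norm_eq_abs, sub_self, abs_zero, sub_zero]
    refine max_le (by linarith) (max_le (by linarith) (by linarith))
  refine ⟨⟨fun w => fOne f g ε w.1 -
      (horizMap f g ε δ (henonMap f ε δ (henonMap f ε δ (Hinv w)))).1,
    fun w => (horizMap f g ε δ (henonMap f ε δ (henonMap f ε δ (Hinv w)))).2.2, ?_, ?_, ?_⟩, ?_⟩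
  · intro w hw
    refine Prod.ext (by simp) (Prod.ext ?_ rfl)
    exact (key w hw).1
  · intro w hw
    obtain ⟨h3, hn⟩ := key w hw
    simp only [horizMap, henonMap, fOne, h3]
    set q : ℝ × ℝ × ℝ := (w.1, (Hinv w).1, δ (Hinv w)) with hq
    have t1 := aux_taylor f A hf hf2 (f w.1 - ε q) (f w.1)
    have t2 := aux_lip ε e hε hεb q (w.1, g w.1, 0)
    have t3 := aux_lip ε e hε hεb (f w.1 - ε q, w.1, δ q) (f w.1, w.1, 0)
    have n3 : ‖((f w.1 - ε q, w.1, δ q) : ℝ × ℝ × ℝ) - (f w.1, w.1, 0)‖ ≤ e + d := by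
      have a1 := hE0 q
      have a2 := hD0 q
      simp only [Prod.norm_def, Prod.mk_sub_mk, Real.norm_eq_abs, sub_self, abs_zero, sub_zero]
      refine max_le ?_ (max_le (by linarith) (by linarith))
      rw [show f w.1 - ε q - f w.1 = - ε q by ring, abs_neg]; linarith
    replace t3 := t3.trans (mul_le_mul_of_nonneg_left n3 he0)
    replace t2 := t2.trans (mul_le_mul_of_nonneg_left hn he0)
    have s1 : |f w.1 - ε q - f w.1| ^ 2 ≤ e ^ 2 := by
      rw [show f w.1 - ε q - f w.1 = - ε q by ring, abs_neg]
      exact pow_le_pow_left₀ (abs_nonneg _) (hE0 q) 2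
    replace t1 := t1.trans (mul_le_mul_of_nonneg_left s1 hA0)
    have t4 : |deriv f (f w.1) * (ε q - ε (w.1, g w.1, 0))| ≤ A * (e * (G * e + d)) := by
      rw [abs_mul]; exact mul_le_mul (hf1 _) t2 (abs_nonneg _) hA0
    have t5 : |fderiv ℝ ε (f w.1, w.1, 0) (1, 0, 0) * ε (w.1, g w.1, 0)| ≤ e * e := by
      rw [abs_mul]; exact mul_le_mul (hE1 _) (hE0 _) (abs_nonneg _) he0
    have tot : A * e ^ 2 + A * (e * (G * e + d)) + e * (e + d) + e * e ≤
        10 * (1 + A) * (1 + G) * (e ^ 2 + e * d) := by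
      have p1 : 0 ≤ e * d := by positivity
      have p2 : 0 ≤ A * (e * d) := by positivity
      have p3 : 0 ≤ G * (e * d) := by positivity
      have p4 : 0 ≤ A * G * (e * d) := by positivity
      have p5 : 0 ≤ e ^ 2 := by positivity
      have p6 : 0 ≤ A * e ^ 2 := by positivity
      have p7 : 0 ≤ G * e ^ 2 := by positivity
      have p8 : 0 ≤ A * G * e ^ 2 := by positivity
      linarith
    refine le_trans ?_ tot
    rw [abs_le] at t1 t3 t4 t5 ⊢
    constructor <;> linarith [t1.1, t1.2, t3.1, t3.2, t4.1, t4.2, t5.1, t5.2]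
  · intro w hw
    obtain ⟨h3, hn⟩ := key w hw
    simp only [horizMap, henonMap, h3]
    refine (aux_lip δ d hδ hδb _ _).trans ((mul_le_mul_of_nonneg_left hn hd0).trans ?_)
    have p1 : 0 ≤ e * d := by positivity
    have p2 : 0 ≤ A * (e * d) := by positivity
    have p3 : 0 ≤ G * (e * d) := by positivity
    have p4 : 0 ≤ A * G * (e * d) := by positivity
    have p5 : 0 ≤ d ^ 2 := by positivity
    have p6 : 0 ≤ A * d ^ 2 := by positivity
    have p7 : 0 ≤ G * d ^ 2 := by positivity
    have p8 : 0 ≤ A * G * d ^ 2 := by positivity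
    linarith
  · intro x _
    have t1 : |(deriv f (f x) - fderiv ℝ ε (f x, x, 0) (1, 0, 0)) * ε (x, g x, 0)| ≤
        (A + 1) * e := by
      rw [abs_mul]
      refine mul_le_mul ?_ (hE0 _) (abs_nonneg _) (by positivity)
      exact (abs_sub _ _).trans (add_le_add (hf1 _) ((hE1 _).trans he))
    have t2 := hE0 (f x, x, 0)
    have p2 : 0 ≤ A * e := by positivity
    have p3 : 0 ≤ G * e := by positivity
    have p4 : 0 ≤ A * G * e := by positivity
    have tot : e + (A + 1) * e ≤ 10 * (1 + A) * (1 + G) * e := by linarith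
    refine le_trans ?_ tot
    unfold fOne
    rw [abs_le] at t1 t2 ⊢
    constructor <;> linarith [t1.1, t1.2, t2.1, t2.2]
end

section
/- Let F : X → X be a continuous map on a complete metric space carrying a dyadic piece structure with constants C > 0 and σ ∈ (0,1), and let O be its critical Cantor set. Then for every 2-adic integer x ∈ ℤ₂ the intersection ⋂_{n≥1} B^n_{x mod 2ⁿ} consists of exactly one point h(x), the resulting map h : ℤ₂ → X is a homeomorphism from ℤ₂ onto O, and h(x + 1) = F(h(x)) for every x ∈ ℤ₂. In particular F(O) ⊆ O and the restriction F|_O is topologically conjugate to the dyadic adding machine x ↦ x + 1 acting on the 2-adic integers ℤ₂. -/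
/-- A dyadic piece structure for a map `F` on a complete metric space, with constants
`C > 0` and `σ ∈ (0,1)`.  `piece n a` is the piece `B^{n+1}_a` of level `n+1`,
indexed by residues `a ∈ ℤ/2^{n+1}ℤ`. -/
structure DyadicPieces {X : Type*} [MetricSpace X] (F : X → X) (C σ : ℝ) where
  piece : (n : ℕ) → ZMod (2 ^ (n + 1)) → Set X
  nonempty : ∀ (n : ℕ) (a : ZMod (2 ^ (n + 1))), (piece n a).Nonempty
  isCompact : ∀ (n : ℕ) (a : ZMod (2 ^ (n + 1))), IsCompact (piece n a)
  nested : ∀ (n : ℕ) (a : ZMod (2 ^ (n + 2))),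
    piece (n + 1) a ⊆
      piece n (ZMod.castHom (pow_dvd_pow 2 (Nat.le_succ (n + 1))) (ZMod (2 ^ (n + 1))) a)
  disjoint : ∀ (n : ℕ) (a b : ZMod (2 ^ (n + 1))), a ≠ b → Disjoint (piece n a) (piece n b)
  mapsTo : ∀ (n : ℕ) (a : ZMod (2 ^ (n + 1))), Set.MapsTo F (piece n a) (piece n (a + 1))
  diam_le : ∀ (n : ℕ) (a : ZMod (2 ^ (n + 1))), Metric.diam (piece n a) ≤ C * σ ^ (n + 1)

/-- The critical Cantor set of a dyadic piece structure. -/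
def DyadicPieces.cantorSet {X : Type*} [MetricSpace X] {F : X → X} {C σ : ℝ}
    (P : DyadicPieces F C σ) : Set X :=
  ⋂ n : ℕ, ⋃ a : ZMod (2 ^ (n + 1)), P.piece n a

/-- For a continuous map `F` on a complete metric space carrying a dyadic
piece structure, for every 2-adic integer `x` the intersection `⋂ₙ B^n_{x mod 2ⁿ}` is a
single point `h x`; the map `h : ℤ₂ → X` is a homeomorphism onto the critical Cantor set,
it conjugates the adding machine `x ↦ x + 1` to `F`, and `F` maps the Cantor set into
itself. -/
theorem stmt_1 {X : Type*} [MetricSpace X] [CompleteSpace X] (F : X → X)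
    (hF : Continuous F) (C σ : ℝ) (hC : 0 < C) (hσ0 : 0 < σ) (hσ1 : σ < 1)
    (P : DyadicPieces F C σ) :
    ∃ h : ℤ_[2] → X,
      (∀ x : ℤ_[2],
        (⋂ n : ℕ, P.piece n (PadicInt.toZModPow (n + 1) x)) = {h x}) ∧
      (∃ e : ℤ_[2] ≃ₜ P.cantorSet, ∀ x : ℤ_[2], (e x : X) = h x) ∧
      (∀ x : ℤ_[2], h (x + 1) = F (h x)) ∧
      Set.MapsTo F P.cantorSet P.cantorSet := by
  have hmem : ∀ x : ℤ_[2], ∃ y, y ∈ ⋂ n : ℕ, P.piece n (PadicInt.toZModPow (n + 1) x) := by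
    intro x
    refine IsCompact.nonempty_iInter_of_sequence_nonempty_isCompact_isClosed
      (fun n : ℕ => P.piece n (PadicInt.toZModPow (n + 1) x)) ?_ (fun n => P.nonempty _ _)
      (P.isCompact _ _) (fun n => (P.isCompact _ _).isClosed)
    intro n
    have h1 := P.nested n (PadicInt.toZModPow (n + 2) x)
    have h2 := PadicInt.cast_toZModPow (p := 2) (n + 1) (n + 2) (by omega) x
    rw [ZMod.castHom_apply, h2] at h1
    exact h1
  have hlim : Filter.Tendsto (fun n : ℕ => C * σ ^ (n + 1)) Filter.atTop (nhds 0) := by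
    have := ((tendsto_pow_atTop_nhds_zero_of_lt_one hσ0.le hσ1).comp
      (Filter.tendsto_add_atTop_nat 1)).const_mul C
    simpa using this
  have hdist : ∀ n a y z, y ∈ P.piece n a → z ∈ P.piece n a → dist y z ≤ C * σ ^ (n + 1) :=
    fun n a y z hy hz =>
      (Metric.dist_le_diam_of_mem (P.isCompact n a).isBounded hy hz).trans (P.diam_le n a)
  choose h hh using hmem
  have hh' : ∀ x n, h x ∈ P.piece n (PadicInt.toZModPow (n + 1) x) := fun x =>
    Set.mem_iInter.1 (hh x)
  have huniq : ∀ x y, (∀ n, y ∈ P.piece n (PadicInt.toZModPow (n + 1) x)) → y = h x := by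
    intro x y hy
    refine dist_le_zero.1 (ge_of_tendsto' hlim fun n => ?_)
    exact hdist n _ _ _ (hy n) (hh' x n)
  have hinjp : ∀ n a b y, y ∈ P.piece n a → y ∈ P.piece n b → a = b := by
    intro n a b y ha hb
    by_contra hab
    exact Set.disjoint_left.1 (P.disjoint n a b hab) ha hb
  have hstep : ∀ x : ℤ_[2], h (x + 1) = F (h x) := by
    intro x
    refine (huniq (x + 1) _ fun n => ?_).symm
    rw [map_add, map_one]
    exact P.mapsTo n _ (hh' x n)
  have hcont : Continuous h := by
    rw [Metric.continuous_iff]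
    intro x ε hε
    obtain ⟨n, hn⟩ := (hlim.eventually (gt_mem_nhds hε)).exists
    refine ⟨((2 : ℕ) : ℝ) ^ (-((n + 1 : ℕ) : ℤ)), by positivity, fun y hy => ?_⟩
    rw [dist_eq_norm] at hy
    have h1 := (PadicInt.norm_le_pow_iff_mem_span_pow (y - x) (n + 1)).1 hy.le
    rw [← PadicInt.ker_toZModPow, RingHom.mem_ker, map_sub, sub_eq_zero] at h1
    refine (hdist n _ _ _ (hh' y n) ?_).trans_lt hn
    rw [h1]
    exact hh' x n
  have hinj : Function.Injective h := by
    intro x y hxy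
    refine PadicInt.ext_of_toZModPow.1 fun n => ?_
    have h1 : PadicInt.toZModPow (n + 1) x = PadicInt.toZModPow (n + 1) y :=
      hinjp n _ _ (h x) (hh' x n) (hxy ▸ hh' y n)
    rw [← PadicInt.cast_toZModPow n (n + 1) (by omega) x, h1,
      PadicInt.cast_toZModPow n (n + 1) (by omega) y]
  have hO : ∀ x, h x ∈ P.cantorSet := fun x =>
    Set.mem_iInter.2 fun n => Set.mem_iUnion.2 ⟨_, hh' x n⟩
  have hsurj : ∀ y ∈ P.cantorSet, ∃ x, h x = y := by
    intro y hy
    have hy' : ∀ n, ∃ a, y ∈ P.piece n a := fun n => Set.mem_iUnion.1 (Set.mem_iInter.1 hy n)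
    choose a ha using hy'
    have hcast : ∀ n, (ZMod.cast (a (n + 1)) : ZMod (2 ^ (n + 1))) = a n := by
      intro n
      have h1 := P.nested n _ (ha (n + 1))
      rw [ZMod.castHom_apply] at h1
      exact hinjp n _ _ y h1 (ha n)
    have hex : ∃ x, x ∈ ⋂ n : ℕ, {x : ℤ_[2] | h x ∈ P.piece n (a n)} := by
      have hcl : ∀ n, IsClosed {x : ℤ_[2] | h x ∈ P.piece n (a n)} := fun n =>
        (P.isCompact n (a n)).isClosed.preimage hcont
      refine IsCompact.nonempty_iInter_of_sequence_nonempty_isCompact_isClosed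
        (fun n : ℕ => {x : ℤ_[2] | h x ∈ P.piece n (a n)}) ?_ ?_ (hcl 0).isCompact hcl
      · intro n x hx
        have h1 := P.nested n _ hx
        rw [ZMod.castHom_apply, hcast] at h1
        exact h1
      · intro n
        refine ⟨((a n).val : ℤ_[2]), ?_⟩
        have h1 := hh' ((a n).val : ℤ_[2]) n
        rw [map_natCast, ZMod.natCast_zmod_val] at h1
        exact h1
    obtain ⟨x, hx⟩ := hex
    refine ⟨x, (huniq x y fun n => ?_).symm⟩
    rw [hinjp n _ _ _ (hh' x n) (Set.mem_iInter.1 hx n)]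
    exact ha n
  refine ⟨h, fun x => ?_, ?_, hstep, ?_⟩
  · ext y
    rw [Set.mem_iInter, Set.mem_singleton_iff]
    exact ⟨huniq x y, fun e n => e ▸ hh' x n⟩
  · let f : ℤ_[2] → P.cantorSet := fun x => ⟨h x, hO x⟩
    have hf : Function.Bijective f :=
      ⟨fun x y hxy => hinj (congrArg Subtype.val hxy), fun y => by
        obtain ⟨x, hx⟩ := hsurj y y.2
        exact ⟨x, Subtype.ext hx⟩⟩
    have hfc : Continuous (Equiv.ofBijective f hf) := hcont.subtype_mk hO
    exact ⟨hfc.homeoOfEquivCompactToT2, fun x => rfl⟩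
  · intro y hy
    obtain ⟨x, rfl⟩ := hsurj y hy
    rw [← hstep]
    exact hO _
end

section
/- Let F : X → X be a continuous map on a complete metric space carrying a dyadic piece structure with constants C > 0 and σ ∈ (0,1), and let O be its critical Cantor set. Then there exists exactly one Borel probability measure μ on X that is invariant under F and supported on O; moreover μ(B^n_a ∩ O) = 2^{−n} for every n ≥ 1 and every a ∈ ℤ/2ⁿℤ, and the support of μ equals O. -/
open MeasureTheory

namespace DyadicPieces

variable {X : Type*} [MetricSpace X] {F : X → X} {C σ : ℝ}

lemma dist_le' (P : DyadicPieces F C σ) {n : ℕ} {a : ZMod (2 ^ (n + 1))} {x y : X}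
    (hx : x ∈ P.piece n a) (hy : y ∈ P.piece n a) : dist x y ≤ C * σ ^ (n + 1) :=
  (Metric.dist_le_diam_of_mem (P.isCompact n a).isBounded hx hy).trans (P.diam_le n a)

lemma index_unique (P : DyadicPieces F C σ) {n : ℕ} {a b : ZMod (2 ^ (n + 1))} {x : X}
    (hx : x ∈ P.piece n a) (hy : x ∈ P.piece n b) : a = b := by
  by_contra h
  exact Set.disjoint_left.1 (P.disjoint n a b h) hx hy

lemma small (hσ0 : 0 < σ) (hσ1 : σ < 1) (C : ℝ) {ε : ℝ} (hε : 0 < ε) :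
    ∃ n : ℕ, C * σ ^ (n + 1) < ε := by
  have h := ((tendsto_pow_atTop_nhds_zero_of_lt_one hσ0.le hσ1).const_mul C)
  rw [mul_zero] at h
  have h2 := (Filter.tendsto_add_atTop_iff_nat 1).2 h
  exact ((h2.eventually (gt_mem_nhds hε))).exists

lemma exists_point (P : DyadicPieces F C σ) (z : ℤ_[2]) :
    ∃ x : X, ∀ n, x ∈ P.piece n (PadicInt.toZModPow (n + 1) z) := by
  have := IsCompact.nonempty_iInter_of_sequence_nonempty_isCompact_isClosed
    (fun n => P.piece n (PadicInt.toZModPow (n + 1) z)) ?_ (fun n => P.nonempty _ _)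
    (P.isCompact _ _) (fun n => (P.isCompact _ _).isClosed)
  · obtain ⟨x, hx⟩ := this
    exact ⟨x, fun n => Set.mem_iInter.1 hx n⟩
  · intro n
    have h := P.nested n (PadicInt.toZModPow (n + 1 + 1) z)
    have e := PadicInt.zmod_cast_comp_toZModPow (p := 2) (n + 1) (n + 1 + 1) (Nat.le_succ _)
    rw [← e]
    exact h

lemma isClosed_level (P : DyadicPieces F C σ) (n : ℕ) :
    IsClosed (⋃ a : ZMod (2 ^ (n + 1)), P.piece n a) := by
  have : NeZero (2 ^ (n + 1)) := ⟨by positivity⟩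
  exact isClosed_iUnion_of_finite fun a => (P.isCompact n a).isClosed

lemma isClosed_cantorSet (P : DyadicPieces F C σ) : IsClosed P.cantorSet :=
  isClosed_iInter fun n => P.isClosed_level n

lemma mem_cantorSet (P : DyadicPieces F C σ) {x : X} :
    x ∈ P.cantorSet ↔ ∀ n, ∃ a, x ∈ P.piece n a := by
  simp [cantorSet]

variable [MeasurableSpace X] [BorelSpace X]

/-- Existence, by pushing forward the Haar measure of the 2-adic integers. -/
lemma exists_measure (P : DyadicPieces F C σ) (hF : Continuous F) (hσ0 : 0 < σ) (hσ1 : σ < 1) :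
    ∃ μ : Measure X, IsProbabilityMeasure μ ∧
        (∀ E : Set X, MeasurableSet E → μ (F ⁻¹' E) = μ E) ∧
        μ P.cantorSet = 1 := by
  choose f hf using P.exists_point
  have hcont : Continuous f := by
    rw [Metric.continuous_iff]
    intro z ε hε
    obtain ⟨n, hn⟩ := small hσ0 hσ1 C hε
    refine ⟨(2 : ℝ) ^ (-((n + 1 : ℕ) : ℤ)), by positivity, fun w hw => ?_⟩
    have e : PadicInt.toZModPow (n + 1) w = PadicInt.toZModPow (n + 1) z := by
      rw [← sub_eq_zero, ← map_sub, ← RingHom.mem_ker, PadicInt.ker_toZModPow,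
        ← PadicInt.norm_le_pow_iff_mem_span_pow]
      rw [dist_eq_norm] at hw
      exact_mod_cast hw.le
    have h1 := hf w n
    rw [e] at h1
    exact (P.dist_le' h1 (hf z n)).trans_lt hn
  have hsemi : ∀ z, F (f z) = f (z + 1) := by
    intro z
    refine eq_of_forall_dist_le fun ε hε => ?_
    obtain ⟨n, hn⟩ := small hσ0 hσ1 C hε
    have h1 := P.mapsTo n _ (hf z n)
    have h2 := hf (z + 1) n
    rw [map_add, map_one] at h2
    exact (P.dist_le' h1 h2).trans hn.le
  letI : MeasurableSpace ℤ_[2] := borel _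
  have : BorelSpace ℤ_[2] := ⟨rfl⟩
  let m : Measure ℤ_[2] := Measure.addHaarMeasure ⊤
  have hm : m Set.univ = 1 := by
    simpa using Measure.addHaarMeasure_self (K₀ := (⊤ : TopologicalSpace.PositiveCompacts ℤ_[2]))
  have hfm := hcont.measurable
  have hfin : ∀ E : Set X, MeasurableSet E → m.map f E = m (f ⁻¹' E) :=
    fun E hE => Measure.map_apply hfm hE
  refine ⟨m.map f, ⟨?_⟩, ?_, ?_⟩
  · rw [hfin _ MeasurableSet.univ, Set.preimage_univ, hm]
  · intro E hE
    rw [hfin _ (hF.measurable hE), hfin _ hE]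
    have : f ⁻¹' (F ⁻¹' E) = (fun z => z + 1) ⁻¹' (f ⁻¹' E) := by
      ext z
      simp [hsemi]
    rw [this, measure_preimage_add_right]
  · rw [hfin _ P.isClosed_cantorSet.measurableSet]
    have : f ⁻¹' P.cantorSet = Set.univ := by
      ext z
      simp only [Set.mem_preimage, Set.mem_univ, iff_true]
      exact P.mem_cantorSet.2 fun n => ⟨_, hf z n⟩
    rw [this, hm]

/-- Every invariant probability measure carried by the Cantor set is equidistributed. -/
lemma measure_piece (P : DyadicPieces F C σ) (hF : Continuous F) (ν : Measure X)
    (h1 : IsProbabilityMeasure ν)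
    (h2 : ∀ E : Set X, MeasurableSet E → ν (F ⁻¹' E) = ν E) (h3 : ν P.cantorSet = 1)
    (n : ℕ) (a : ZMod (2 ^ (n + 1))) :
    ν (P.piece n a ∩ P.cantorSet) = ((2 : ENNReal) ^ (n + 1))⁻¹ := by
  have : NeZero (2 ^ (n + 1)) := ⟨by positivity⟩
  have hOm := P.isClosed_cantorSet.measurableSet
  have hpm : ∀ a, MeasurableSet (P.piece n a) := fun a => (P.isCompact n a).isClosed.measurableSet
  have hO : ∀ᵐ x ∂ν, x ∈ P.cantorSet := by
    exact (prob_compl_eq_zero_iff hOm).2 h3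
  have hinter : ∀ E : Set X, ν (E ∩ P.cantorSet) = ν E := by
    intro E
    apply measure_congr
    filter_upwards [hO] with x hx
    exact propext ⟨fun h => h.1, fun h => ⟨h, hx⟩⟩
  have hstep : ∀ a, ν (P.piece n (a + 1)) = ν (P.piece n a) := by
    intro a
    rw [← h2 _ (hpm _)]
    apply measure_congr
    filter_upwards [hO] with x hx
    refine propext ⟨fun h => ?_, fun h => P.mapsTo n a h⟩
    obtain ⟨b, hb⟩ := P.mem_cantorSet.1 hx n
    have := P.index_unique h (P.mapsTo n b hb)
    rw [add_right_cancel this]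
    exact hb
  have hall : ∀ k : ℕ, ν (P.piece n (k : ZMod (2 ^ (n + 1)))) = ν (P.piece n 0) := by
    intro k
    induction k with
    | zero => simp
    | succ k ih => rw [Nat.cast_succ, hstep, ih]
  have hall' : ∀ b, ν (P.piece n b) = ν (P.piece n 0) := by
    intro b
    rw [← hall b.val, ZMod.natCast_zmod_val]
  have hsum : ν (⋃ b, P.piece n b) = 1 := by
    apply le_antisymm prob_le_one
    rw [← h3]
    exact measure_mono (Set.iInter_subset _ n)
  rw [measure_iUnion (fun i j hij => P.disjoint n i j hij) hpm, tsum_fintype] at hsum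
  simp only [hall', Finset.sum_const, Finset.card_univ, ZMod.card, nsmul_eq_mul] at hsum
  rw [hinter, hall']
  push_cast at hsum
  exact ENNReal.eq_inv_of_mul_eq_one_left (by rwa [mul_comm])

/-- Measures carried by the Cantor set and agreeing on the pieces agree. -/
lemma measure_unique (P : DyadicPieces F C σ) (hσ0 : 0 < σ) (hσ1 : σ < 1) (μ ν : Measure X)
    (hμ : IsProbabilityMeasure μ) (hν : IsProbabilityMeasure ν)
    (hμO : μ P.cantorSet = 1) (hνO : ν P.cantorSet = 1)
    (h : ∀ (n : ℕ) (a : ZMod (2 ^ (n + 1))),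
      ν (P.piece n a ∩ P.cantorSet) = μ (P.piece n a ∩ P.cantorSet)) : ν = μ := by
  have hOm := P.isClosed_cantorSet.measurableSet
  have hinter : ∀ (ρ : Measure X), IsProbabilityMeasure ρ → ρ P.cantorSet = 1 →
      ∀ E : Set X, ρ (E ∩ P.cantorSet) = ρ E := by
    intro ρ _ hρ E
    have hO : ∀ᵐ x ∂ρ, x ∈ P.cantorSet := by
      exact (prob_compl_eq_zero_iff hOm).2 hρ
    apply measure_congr
    filter_upwards [hO] with x hx
    exact propext ⟨fun h => h.1, fun h => ⟨h, hx⟩⟩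
  refine ext_of_generate_finite {s : Set X | IsClosed s}
    (by rw [BorelSpace.measurable_eq (α := X), borel_eq_generateFrom_isClosed])
    isPiSystem_isClosed ?_ (by simp)
  intro K hK
  let U : ℕ → Set X := fun n =>
    ⋃ a : {a : ZMod (2 ^ (n + 1)) // (P.piece n a ∩ K).Nonempty}, P.piece n a ∩ P.cantorSet
  have hUm : ∀ n, MeasurableSet (U n) := by
    intro n
    have : NeZero (2 ^ (n + 1)) := ⟨by positivity⟩
    exact MeasurableSet.iUnion fun a => ((P.isCompact n a).isClosed.measurableSet).inter hOm
  have hUanti : Antitone U := by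
    refine antitone_nat_of_succ_le fun n x hx => ?_
    obtain ⟨⟨a, y, hy, hyK⟩, hx, hxO⟩ := Set.mem_iUnion.1 hx
    exact Set.mem_iUnion.2 ⟨⟨_, y, P.nested n a hy, hyK⟩, P.nested n a hx, hxO⟩
  have hUeq : ∀ n, ν (U n) = μ (U n) := by
    intro n
    have : NeZero (2 ^ (n + 1)) := ⟨by positivity⟩
    have hd : Pairwise (Function.onFun Disjoint
        fun a : {a : ZMod (2 ^ (n + 1)) // (P.piece n a ∩ K).Nonempty} =>
          P.piece n a ∩ P.cantorSet) := fun i j hij =>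
      (P.disjoint n i j (fun e => hij (Subtype.ext e))).mono
        Set.inter_subset_left Set.inter_subset_left
    have hmm : ∀ a : {a : ZMod (2 ^ (n + 1)) // (P.piece n a ∩ K).Nonempty},
        MeasurableSet (P.piece n a ∩ P.cantorSet) := fun a =>
      ((P.isCompact n a).isClosed.measurableSet).inter hOm
    rw [measure_iUnion hd hmm, measure_iUnion hd hmm]
    exact tsum_congr fun a => h n a
  have hUK : ⋂ n, U n = K ∩ P.cantorSet := by
    ext x
    rw [Set.mem_iInter]
    constructor
    · intro hx
      refine ⟨?_, ?_⟩
      · rw [← hK.closure_eq, Metric.mem_closure_iff]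
        intro ε hε
        obtain ⟨n, hn⟩ := small hσ0 hσ1 C hε
        obtain ⟨⟨a, y, hy, hyK⟩, hx, hxO⟩ := Set.mem_iUnion.1 (hx n)
        exact ⟨y, hyK, (P.dist_le' hx hy).trans_lt hn⟩
      · obtain ⟨_, _, hxO⟩ := Set.mem_iUnion.1 (hx 0)
        exact hxO
    · rintro ⟨hxK, hxO⟩ n
      obtain ⟨a, ha⟩ := P.mem_cantorSet.1 hxO n
      exact Set.mem_iUnion.2 ⟨⟨a, x, ha, hxK⟩, ha, hxO⟩
  rw [← hinter ν hν hνO K, ← hinter μ hμ hμO K, ← hUK]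
  have t1 := tendsto_measure_iInter_atTop (μ := ν) (fun n => (hUm n).nullMeasurableSet) hUanti
    ⟨0, measure_ne_top _ _⟩
  have t2 := tendsto_measure_iInter_atTop (μ := μ) (fun n => (hUm n).nullMeasurableSet) hUanti
    ⟨0, measure_ne_top _ _⟩
  refine tendsto_nhds_unique t1 (t2.congr fun n => ?_)
  exact (hUeq n).symm

end DyadicPieces


open MeasureTheory in
/-- A continuous map on a complete metric space carrying a dyadic piece
structure has exactly one invariant Borel probability measure supported on its critical
Cantor set; this measure gives each level-`n` piece (intersected with the Cantor set)
measure `2^{-n}` and its topological support is exactly the Cantor set. -/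
theorem stmt_2 {X : Type*} [MetricSpace X] [CompleteSpace X]
    [MeasurableSpace X] [BorelSpace X]
    (F : X → X) (hF : Continuous F) (C σ : ℝ) (hC : 0 < C) (hσ0 : 0 < σ) (hσ1 : σ < 1)
    (P : DyadicPieces F C σ) :
    ∃ μ : Measure X,
      (IsProbabilityMeasure μ ∧
        (∀ E : Set X, MeasurableSet E → μ (F ⁻¹' E) = μ E) ∧
        μ P.cantorSet = 1) ∧
      (∀ ν : Measure X,
        (IsProbabilityMeasure ν ∧
          (∀ E : Set X, MeasurableSet E → ν (F ⁻¹' E) = ν E) ∧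
          ν P.cantorSet = 1) → ν = μ) ∧
      (∀ (n : ℕ) (a : ZMod (2 ^ (n + 1))),
        μ (P.piece n a ∩ P.cantorSet) = ((2 : ENNReal) ^ (n + 1))⁻¹) ∧
      {x : X | ∀ U : Set X, IsOpen U → x ∈ U → 0 < μ U} = P.cantorSet := by
  obtain ⟨μ, h1, h2, h3⟩ := P.exists_measure hF hσ0 hσ1
  have hp := P.measure_piece hF μ h1 h2 h3
  refine ⟨μ, ⟨h1, h2, h3⟩, ?_, hp, ?_⟩
  · rintro ν ⟨g1, g2, g3⟩
    refine P.measure_unique hσ0 hσ1 μ ν h1 g1 h3 g3 fun n a => ?_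
    rw [hp, P.measure_piece hF ν g1 g2 g3]
  · ext x
    rw [Set.mem_setOf_eq]
    constructor
    · intro hx
      by_contra hxO
      have hpos := hx _ P.isClosed_cantorSet.isOpen_compl hxO
      rw [(prob_compl_eq_zero_iff P.isClosed_cantorSet.measurableSet).2 h3] at hpos
      exact lt_irrefl _ hpos
    · intro hxO U hU hxU
      obtain ⟨ε, hε, hball⟩ := Metric.isOpen_iff.1 hU x hxU
      obtain ⟨n, hn⟩ := DyadicPieces.small hσ0 hσ1 C hε
      obtain ⟨a, ha⟩ := P.mem_cantorSet.1 hxO n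
      have hsub : P.piece n a ∩ P.cantorSet ⊆ U := fun y hy =>
        hball ((P.dist_le' hy.1 ha).trans_lt hn)
      refine lt_of_lt_of_le ?_ (measure_mono hsub)
      rw [hp]
      exact ENNReal.inv_pos.2 (by finiteness)
end

section
/- Let B ⊆ ℝ³ be compact, let F : B → B be a C¹ map with Jacobian determinant Jac F(w) := det DF(w) > 0 on B, and suppose w ↦ log Jac F(w) is Lipschitz on B with constant L. Suppose F carries a dyadic piece structure with constants C > 0 and σ ∈ (0, 1/2). Then for every n ≥ 1, every a ∈ ℤ/2ⁿℤ, every integer k with 1 ≤ k ≤ 2ⁿ, and all points y, z ∈ B^n_a, one has |log Jac F^k(y) − log Jac F^k(z)| ≤ L·C·(2σ)ⁿ. In particular, since 2σ < 1, the distortion of Jac F^k on level-n pieces decays exponentially in n. -/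
/-- The Jacobian determinant of a map of `ℝ³`. -/
noncomputable def jac (F : EuclideanSpace ℝ (Fin 3) → EuclideanSpace ℝ (Fin 3))
    (w : EuclideanSpace ℝ (Fin 3)) : ℝ :=
  LinearMap.det (fderiv ℝ F w).toLinearMap

/-- The Jacobian determinant of the `k`-th iterate of `F` (via the chain rule). -/
noncomputable def jacIter (F : EuclideanSpace ℝ (Fin 3) → EuclideanSpace ℝ (Fin 3))
    (k : ℕ) (w : EuclideanSpace ℝ (Fin 3)) : ℝ :=
  ∏ i ∈ Finset.range k, jac F (F^[i] w)

/-- **Distortion Lemma.** If `F : B → B` is `C¹` on a compact `B ⊆ ℝ³` with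
positive Jacobian whose logarithm is `L`-Lipschitz on `B`, and `F` carries a dyadic piece
structure with `σ < 1/2`, then for `1 ≤ k ≤ 2ⁿ` and `y, z` in a level-`n` piece,
`|log Jac F^k(y) − log Jac F^k(z)| ≤ L·C·(2σ)ⁿ`. -/
theorem stmt_3 (B : Set (EuclideanSpace ℝ (Fin 3))) (hB : IsCompact B)
    (F : EuclideanSpace ℝ (Fin 3) → EuclideanSpace ℝ (Fin 3))
    (hF : ContDiff ℝ 1 F) (hFB : Set.MapsTo F B B)
    (L : ℝ)
    (hpos : ∀ w ∈ B, 0 < jac F w)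
    (hLip : ∀ y ∈ B, ∀ z ∈ B,
      |Real.log (jac F y) - Real.log (jac F z)| ≤ L * dist y z)
    (C σ : ℝ) (hC : 0 < C) (hσ0 : 0 < σ) (hσ : σ < 1 / 2)
    (P : DyadicPieces F C σ)
    (hPB : ∀ (n : ℕ) (a : ZMod (2 ^ (n + 1))), P.piece n a ⊆ B) :
    ∀ (n : ℕ) (a : ZMod (2 ^ (n + 1))) (k : ℕ), 1 ≤ k → k ≤ 2 ^ (n + 1) →
      ∀ y ∈ P.piece n a, ∀ z ∈ P.piece n a,
        |Real.log (jacIter F k y) - Real.log (jacIter F k z)| ≤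
          L * C * (2 * σ) ^ (n + 1) := by
  intro n a k _ hk y hy z hz
  have hL : 0 ≤ L := by
    obtain ⟨p, hp⟩ := P.nonempty 0 0
    obtain ⟨q, hq⟩ := P.nonempty 0 1
    have hne : p ≠ q := by
      rintro rfl
      have h01 : (0 : ZMod (2 ^ (0 + 1))) ≠ 1 := by decide
      exact Set.disjoint_left.mp (P.disjoint 0 0 1 h01) hp hq
    have h := (abs_nonneg _).trans (hLip p (hPB _ _ hp) q (hPB _ _ hq))
    exact nonneg_of_mul_nonneg_left h (dist_pos.mpr hne)
  have hit : ∀ (i : ℕ) (w : EuclideanSpace ℝ (Fin 3)), w ∈ P.piece n a →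
      F^[i] w ∈ P.piece n (a + (i : ZMod (2 ^ (n + 1)))) := by
    intro i w hw
    induction i with
    | zero => simpa using hw
    | succ i ih =>
      rw [Function.iterate_succ_apply', Nat.cast_succ, ← add_assoc]
      exact P.mapsTo n _ ih
  have hlog : ∀ w ∈ P.piece n a, Real.log (jacIter F k w) =
      ∑ i ∈ Finset.range k, Real.log (jac F (F^[i] w)) := by
    intro w hw
    unfold jacIter
    exact Real.log_prod fun i _ => (hpos _ (hPB _ _ (hit i w hw))).ne'
  rw [hlog y hy, hlog z hz, ← Finset.sum_sub_distrib]
  have hterm : ∀ i ∈ Finset.range k,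
      |Real.log (jac F (F^[i] y)) - Real.log (jac F (F^[i] z))| ≤ L * (C * σ ^ (n + 1)) := by
    intro i _
    refine (hLip _ (hPB _ _ (hit i y hy)) _ (hPB _ _ (hit i z hz))).trans ?_
    refine mul_le_mul_of_nonneg_left ?_ hL
    exact (Metric.dist_le_diam_of_mem (P.isCompact n _).isBounded (hit i y hy)
      (hit i z hz)).trans (P.diam_le n _)
  have hsum := (Finset.abs_sum_le_sum_abs _ _).trans (Finset.sum_le_card_nsmul _ _ _ hterm)
  rw [Finset.card_range, nsmul_eq_mul] at hsum
  have hk' : (k : ℝ) ≤ 2 ^ (n + 1) := by exact_mod_cast hk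
  calc _ ≤ (k : ℝ) * (L * (C * σ ^ (n + 1))) := hsum
    _ ≤ 2 ^ (n + 1) * (L * (C * σ ^ (n + 1))) :=
      mul_le_mul_of_nonneg_right hk' (by positivity)
    _ = L * C * (2 * σ) ^ (n + 1) := by rw [mul_pow]; ring
end

section
/- Let B ⊆ ℝ³ be compact, let F : B → B be a C¹ map with Jacobian determinant Jac F(w) := det DF(w) > 0 on B such that log Jac F is Lipschitz on B with constant L, and suppose F carries a dyadic piece structure with constants C > 0 and σ ∈ (0, 1/2). Let μ be an F-invariant Borel probability measure with μ(B^n_a) = 2^{−n} for all n ≥ 1 and a ∈ ℤ/2ⁿℤ and with μ(⋃_a B^n_a) = 1 for each n, and set b := exp(∫ log Jac F dμ). Then there is a constant C' > 0 such that for every n ≥ 1, every a ∈ ℤ/2ⁿℤ, and every point w ∈ B^n_a, one has |log Jac F^{2ⁿ}(w) − 2ⁿ log b| ≤ C'(2σ)ⁿ; equivalently, Jac F^{2ⁿ}(w) = b^{2ⁿ}(1 + O((2σ)ⁿ)) uniformly over the level-n pieces. -/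
open MeasureTheory in
/-- Under the hypotheses of the distortion lemma, if `μ` is an invariant
Borel probability measure giving each level-`n` piece measure `2^{-n}` and full measure to
their union, and `b := exp ∫ log Jac F dμ` is the average Jacobian, then uniformly on the
level-`n` pieces `Jac F^{2ⁿ}(w) = b^{2ⁿ}(1 + O((2σ)ⁿ))`, i.e.
`|log Jac F^{2ⁿ}(w) − 2ⁿ log b| ≤ C'(2σ)ⁿ`. -/
theorem stmt_4 (B : Set (EuclideanSpace ℝ (Fin 3))) (hB : IsCompact B)
    (F : EuclideanSpace ℝ (Fin 3) → EuclideanSpace ℝ (Fin 3))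
    (hF : ContDiff ℝ 1 F) (hFB : Set.MapsTo F B B)
    (L : ℝ)
    (hpos : ∀ w ∈ B, 0 < jac F w)
    (hLip : ∀ y ∈ B, ∀ z ∈ B,
      |Real.log (jac F y) - Real.log (jac F z)| ≤ L * dist y z)
    (C σ : ℝ) (hC : 0 < C) (hσ0 : 0 < σ) (hσ : σ < 1 / 2)
    (P : DyadicPieces F C σ)
    (hPB : ∀ (n : ℕ) (a : ZMod (2 ^ (n + 1))), P.piece n a ⊆ B)
    (μ : Measure (EuclideanSpace ℝ (Fin 3)))
    (hprob : IsProbabilityMeasure μ)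
    (hinv : ∀ E : Set (EuclideanSpace ℝ (Fin 3)), MeasurableSet E → μ (F ⁻¹' E) = μ E)
    (hμpiece : ∀ (n : ℕ) (a : ZMod (2 ^ (n + 1))),
      μ (P.piece n a) = ((2 : ENNReal) ^ (n + 1))⁻¹)
    (hμfull : ∀ n : ℕ, μ (⋃ a : ZMod (2 ^ (n + 1)), P.piece n a) = 1)
    (b : ℝ) (hb : b = Real.exp (∫ x, Real.log (jac F x) ∂μ)) :
    ∃ C' : ℝ, 0 < C' ∧
      ∀ (n : ℕ) (a : ZMod (2 ^ (n + 1))), ∀ w ∈ P.piece n a,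
        |Real.log (jacIter F (2 ^ (n + 1)) w) - (2 ^ (n + 1) : ℝ) * Real.log b| ≤
          C' * (2 * σ) ^ (n + 1) := by
  have hlogb : Real.log b = ∫ x, Real.log (jac F x) ∂μ := by rw [hb, Real.log_exp]
  refine ⟨|L| * C + 1, by positivity, ?_⟩
  intro n a w hw
  set φ : EuclideanSpace ℝ (Fin 3) → ℝ := fun x => Real.log (jac F x) with hφ
  have hNpos : 0 < 2 ^ (n + 1) := by positivity
  have : NeZero (2 ^ (n + 1)) := ⟨hNpos.ne'⟩
  have hit : ∀ i : ℕ, F^[i] w ∈ P.piece n (a + (i : ZMod (2 ^ (n + 1)))) := by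
    intro i
    induction i with
    | zero => simpa using hw
    | succ k ih =>
      rw [Function.iterate_succ_apply']
      have := P.mapsTo n _ ih
      simpa [add_assoc] using this
  have hcont : ContinuousOn φ B := by
    apply LipschitzOnWith.continuousOn (K := Real.toNNReal |L|)
    apply LipschitzOnWith.of_dist_le_mul
    intro y hy z hz
    rw [Real.dist_eq, Real.coe_toNNReal _ (abs_nonneg L)]
    exact (hLip y hy z hz).trans (mul_le_mul_of_nonneg_right (le_abs_self L) dist_nonneg)
  have hmeas : ∀ c, MeasurableSet (P.piece n c) := fun c => (P.isCompact n c).measurableSet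
  have hint : ∀ c, IntegrableOn φ (P.piece n c) μ := fun c =>
    (hcont.mono (hPB n c)).integrableOn_compact (P.isCompact n c)
  have hsumlog : Real.log (jacIter F (2 ^ (n + 1)) w)
      = ∑ i ∈ Finset.range (2 ^ (n + 1)), φ (F^[i] w) := by
    unfold jacIter
    rw [Real.log_prod]
    intro i _
    exact (hpos _ (hPB n _ (hit i))).ne'
  have hreindex : ∑ i ∈ Finset.range (2 ^ (n + 1)), φ (F^[i] w)
      = ∑ c : ZMod (2 ^ (n + 1)), φ (F^[(c - a).val] w) := by
    refine Eq.trans ?_ (Equiv.sum_comp (Equiv.subRight a) (fun d => φ (F^[d.val] w))).symm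
    symm
    refine Finset.sum_nbij' (fun d => d.val) (fun i => (i : ZMod (2 ^ (n + 1)))) ?_ ?_ ?_ ?_ ?_
    · intro d _
      exact Finset.mem_range.2 (ZMod.val_lt d)
    · intro i _
      exact Finset.mem_univ _
    · intro d _
      exact ZMod.natCast_zmod_val d
    · intro i hi
      exact ZMod.val_cast_of_lt (Finset.mem_range.1 hi)
    · intro d _
      rfl
  have hmem : ∀ c : ZMod (2 ^ (n + 1)), F^[(c - a).val] w ∈ P.piece n c := by
    intro c
    have := hit (c - a).val
    rwa [ZMod.natCast_zmod_val, add_sub_cancel] at this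
  have hae : (⋃ c, P.piece n c) =ᵐ[μ] (Set.univ : Set (EuclideanSpace ℝ (Fin 3))) := by
    rw [ae_eq_univ]
    exact (prob_compl_eq_zero_iff (MeasurableSet.iUnion hmeas)).2 (hμfull n)
  have hintsum : ∫ x, φ x ∂μ = ∑ c : ZMod (2 ^ (n + 1)), ∫ x in P.piece n c, φ x ∂μ := by
    rw [← setIntegral_univ, ← setIntegral_congr_set hae]
    exact integral_iUnion_fintype hmeas (fun c d hcd => P.disjoint n c d hcd) hint
  have hreal : ∀ c, μ.real (P.piece n c) = ((2 : ℝ) ^ (n + 1))⁻¹ := by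
    intro c
    simp [Measure.real, hμpiece]
  have hkey : ∀ c : ZMod (2 ^ (n + 1)),
      |φ (F^[(c - a).val] w) - (2 : ℝ) ^ (n + 1) * ∫ x in P.piece n c, φ x ∂μ|
        ≤ |L| * C * σ ^ (n + 1) := by
    intro c
    set v := F^[(c - a).val] w with hv
    have hconst : ∫ x in P.piece n c, φ v ∂μ = ((2 : ℝ) ^ (n + 1))⁻¹ * φ v := by
      rw [setIntegral_const, hreal, smul_eq_mul]
    have hsub : ∫ x in P.piece n c, (φ v - φ x) ∂μ
        = ((2 : ℝ) ^ (n + 1))⁻¹ * φ v - ∫ x in P.piece n c, φ x ∂μ := by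
      rw [integral_sub (integrable_const _) (hint c), hconst]
    have hbd : ‖∫ x in P.piece n c, (φ v - φ x) ∂μ‖
        ≤ |L| * C * σ ^ (n + 1) * μ.real (P.piece n c) := by
      apply norm_setIntegral_le_of_norm_le_const (measure_lt_top μ _)
      intro x hx
      rw [Real.norm_eq_abs]
      have h1 := hLip v (hPB n c (hmem c)) x (hPB n c hx)
      have h2 : dist v x ≤ C * σ ^ (n + 1) :=
        (Metric.dist_le_diam_of_mem (P.isCompact n c).isBounded (hmem c) hx).trans (P.diam_le n c)
      calc |φ v - φ x| ≤ L * dist v x := h1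
        _ ≤ |L| * dist v x := mul_le_mul_of_nonneg_right (le_abs_self L) dist_nonneg
        _ ≤ |L| * (C * σ ^ (n + 1)) := mul_le_mul_of_nonneg_left h2 (abs_nonneg L)
        _ = |L| * C * σ ^ (n + 1) := by ring
    rw [hsub, hreal, Real.norm_eq_abs] at hbd
    have h2 : (0 : ℝ) < 2 ^ (n + 1) := by positivity
    have heq : φ v - (2 : ℝ) ^ (n + 1) * ∫ x in P.piece n c, φ x ∂μ
        = (2 : ℝ) ^ (n + 1) * (((2 : ℝ) ^ (n + 1))⁻¹ * φ v - ∫ x in P.piece n c, φ x ∂μ) := by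
      field_simp
    rw [heq, abs_mul, abs_of_pos h2]
    calc _ ≤ (2 : ℝ) ^ (n + 1) * (|L| * C * σ ^ (n + 1) * ((2 : ℝ) ^ (n + 1))⁻¹) :=
          mul_le_mul_of_nonneg_left hbd h2.le
      _ = _ := by field_simp
  rw [hsumlog, hreindex, hlogb, hintsum, Finset.mul_sum, ← Finset.sum_sub_distrib]
  calc _ ≤ ∑ c : ZMod (2 ^ (n + 1)),
        |φ (F^[(c - a).val] w) - (2 : ℝ) ^ (n + 1) * ∫ x in P.piece n c, φ x ∂μ| :=
        Finset.abs_sum_le_sum_abs _ _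
    _ ≤ ∑ c : ZMod (2 ^ (n + 1)), |L| * C * σ ^ (n + 1) := Finset.sum_le_sum fun c _ => hkey c
    _ = |L| * C * (2 * σ) ^ (n + 1) := by
        rw [Finset.sum_const, Finset.card_univ, ZMod.card, nsmul_eq_mul, mul_pow]
        push_cast
        ring
    _ ≤ (|L| * C + 1) * (2 * σ) ^ (n + 1) :=
        mul_le_mul_of_nonneg_right (by linarith) (by positivity)
end

section
/- For each index j let α_j, σ_j, t_j, u_j, d_j be real numbers and let M_j be the 3×3 real matrix with rows (α_j, σ_j t_j, σ_j u_j), (0, σ_j, 0), (0, σ_j d_j, σ_j). Then for all integers 0 ≤ k < n the product M_k · M_{k+1} · … · M_{n−1} equals the 3×3 matrix with rows (A_{n,k}, X_{n,k}, Y_{n,k}), (0, S_{n,k}, 0), (0, S_{n,k}·Σ_{j=k}^{n−1} d_j, S_{n,k}), where A_{n,k} = ∏_{j=k}^{n−1} α_j, S_{n,k} = ∏_{j=k}^{n−1} σ_j (with empty products equal to 1), Y_{n,k} = Σ_{j=k}^{n−1} A_{j,k} · σ_j u_j · S_{n,j+1}, and X_{n,k} = Σ_{j=k}^{n−1} A_{j,k}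 · σ_j (t_j + u_j Σ_{i=j+1}^{n−1} d_i) · S_{n,j+1}. In particular, when all σ_j and α_j are nonzero, this product factors as the matrix with rows (1, X_{n,k}/S_{n,k}, Y_{n,k}/S_{n,k}), (0, 1, 0), (0, Σ_{j=k}^{n−1} d_j, 1) times the diagonal matrix diag(A_{n,k}, S_{n,k}, S_{n,k}). -/
theorem prod_aux (α σs t u d : ℕ → ℝ) (k m : ℕ) :
    ((List.range m).map fun i => (!![α (k+i), σs (k+i) * t (k+i), σs (k+i) * u (k+i);
         0, σs (k+i), 0;
         0, σs (k+i) * d (k+i), σs (k+i)] : Matrix (Fin 3) (Fin 3) ℝ)).prod =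
      !![∏ j ∈ Finset.Ico k (k+m), α j, ∑ j ∈ Finset.Ico k (k+m),
      (∏ i ∈ Finset.Ico k j, α i) *
        (σs j * (t j + u j * ∑ i ∈ Finset.Ico (j + 1) (k+m), d i)) *
        (∏ i ∈ Finset.Ico (j + 1) (k+m), σs i), ∑ j ∈ Finset.Ico k (k+m),
      (∏ i ∈ Finset.Ico k j, α i) * (σs j * u j) * (∏ i ∈ Finset.Ico (j + 1) (k+m), σs i);
         0, ∏ j ∈ Finset.Ico k (k+m), σs j, 0;
         0, (∏ j ∈ Finset.Ico k (k+m), σs j) * ∑ j ∈ Finset.Ico k (k+m), d j,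
          ∏ j ∈ Finset.Ico k (k+m), σs j] := by
  induction m with
  | zero =>
    ext i j
    fin_cases i <;> fin_cases j <;> simp
  | succ m ih =>
    have hk : k ≤ k + m := Nat.le_add_right k m
    have hY : ∑ j ∈ Finset.Ico k (k+m+1), (∏ i ∈ Finset.Ico k j, α i) * (σs j * u j) *
          (∏ i ∈ Finset.Ico (j + 1) (k+m+1), σs i) =
        (∏ j ∈ Finset.Ico k (k+m), α j) * (σs (k+m) * u (k+m)) +
        (∑ j ∈ Finset.Ico k (k+m), (∏ i ∈ Finset.Ico k j, α i) * (σs j * u j) *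
          (∏ i ∈ Finset.Ico (j + 1) (k+m), σs i)) * σs (k+m) := by
      rw [Finset.sum_Ico_succ_top hk, Finset.Ico_self, Finset.prod_empty, mul_one, add_comm,
        Finset.sum_mul]
      congr 1
      refine Finset.sum_congr rfl fun j hj => ?_
      have hj' : j + 1 ≤ k + m := (Finset.mem_Ico.mp hj).2
      rw [Finset.prod_Ico_succ_top hj']
      ring
    have hX : ∑ j ∈ Finset.Ico k (k+m+1), (∏ i ∈ Finset.Ico k j, α i) *
          (σs j * (t j + u j * ∑ i ∈ Finset.Ico (j + 1) (k+m+1), d i)) *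
          (∏ i ∈ Finset.Ico (j + 1) (k+m+1), σs i) =
        (∏ j ∈ Finset.Ico k (k+m), α j) * (σs (k+m) * t (k+m)) +
        (∑ j ∈ Finset.Ico k (k+m), (∏ i ∈ Finset.Ico k j, α i) *
          (σs j * (t j + u j * ∑ i ∈ Finset.Ico (j + 1) (k+m), d i)) *
          (∏ i ∈ Finset.Ico (j + 1) (k+m), σs i)) * σs (k+m) +
        (∑ j ∈ Finset.Ico k (k+m), (∏ i ∈ Finset.Ico k j, α i) * (σs j * u j) *
          (∏ i ∈ Finset.Ico (j + 1) (k+m), σs i)) * (σs (k+m) * d (k+m)) := by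
      rw [Finset.sum_Ico_succ_top hk, Finset.Ico_self, Finset.prod_empty, Finset.sum_empty,
        mul_one, mul_zero, add_zero, add_comm (Finset.sum _ _) (_ * (σs (k+m) * t (k+m))), Finset.sum_mul, Finset.sum_mul,
        add_assoc (_ * (σs (k+m) * t (k+m))), ← Finset.sum_add_distrib]
      congr 1
      refine Finset.sum_congr rfl fun j hj => ?_
      have hj' : j + 1 ≤ k + m := (Finset.mem_Ico.mp hj).2
      rw [Finset.prod_Ico_succ_top hj', Finset.sum_Ico_succ_top hj']
      ring
    rw [List.range_succ, List.map_append, List.prod_append, ih, ← add_assoc, hX, hY,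
      Finset.prod_Ico_succ_top hk, Finset.prod_Ico_succ_top hk, Finset.sum_Ico_succ_top hk]
    ext i j
    fin_cases i <;> fin_cases j <;>
      simp [Matrix.mul_apply, Fin.sum_univ_three]
    ring

/-- Explicit form and unipotent-times-diagonal factorization of the
ordered product `M_k ⋯ M_{n−1}` of the one-step derivative matrices
`M_j = [[α_j, σ_j t_j, σ_j u_j],[0, σ_j, 0],[0, σ_j d_j, σ_j]]`. -/
theorem stmt_5 (α σs t u d : ℕ → ℝ) (k n : ℕ) (hkn : k < n) :
    let M : ℕ → Matrix (Fin 3) (Fin 3) ℝ := fun j =>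
      !![α j, σs j * t j, σs j * u j;
         0, σs j, 0;
         0, σs j * d j, σs j]
    let A : ℝ := ∏ j ∈ Finset.Ico k n, α j
    let S : ℝ := ∏ j ∈ Finset.Ico k n, σs j
    let Y : ℝ := ∑ j ∈ Finset.Ico k n,
      (∏ i ∈ Finset.Ico k j, α i) * (σs j * u j) * (∏ i ∈ Finset.Ico (j + 1) n, σs i)
    let Xe : ℝ := ∑ j ∈ Finset.Ico k n,
      (∏ i ∈ Finset.Ico k j, α i) *
        (σs j * (t j + u j * ∑ i ∈ Finset.Ico (j + 1) n, d i)) *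
        (∏ i ∈ Finset.Ico (j + 1) n, σs i)
    (((List.range (n - k)).map fun i => M (k + i)).prod =
      !![A, Xe, Y;
         0, S, 0;
         0, S * ∑ j ∈ Finset.Ico k n, d j, S]) ∧
    ((∀ j, σs j ≠ 0) → (∀ j, α j ≠ 0) →
      ((List.range (n - k)).map fun i => M (k + i)).prod =
        !![1, Xe / S, Y / S;
           0, 1, 0;
           0, ∑ j ∈ Finset.Ico k n, d j, 1] * Matrix.diagonal ![A, S, S]) := by
  intro M A S Y Xe
  have h1 : ((List.range (n - k)).map fun i => M (k + i)).prod =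
      !![A, Xe, Y;
         0, S, 0;
         0, S * ∑ j ∈ Finset.Ico k n, d j, S] := by
    obtain ⟨m, rfl⟩ := Nat.exists_eq_add_of_le hkn.le
    have h := prod_aux α σs t u d k m
    rw [Nat.add_sub_cancel_left]
    exact h
  refine ⟨h1, fun hσ _ => ?_⟩
  have hS : S ≠ 0 := Finset.prod_ne_zero_iff.mpr fun j _ => hσ j
  rw [h1]
  clear_value S A Y Xe
  ext i j
  fin_cases i <;> fin_cases j <;>
    simp [Matrix.mul_apply, Fin.sum_univ_three, Matrix.diagonal, mul_comm]
  · field_simp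
  · field_simp
end

section
/- Let F : X → X be a continuous map on a complete metric space carrying a dyadic piece structure with constants C > 0 and σ ∈ (0,1), and let O be its critical Cantor set. Then any two distinct points of O are not forward asymptotic: for all w, w' ∈ O with w ≠ w', one has inf_{k ≥ 0} d(F^k(w), F^k(w')) > 0. In particular d(F^k(w), F^k(w')) does not converge to 0 as k → ∞. -/
/-- Two distinct points of the critical Cantor set of a dyadic piece
structure are never forward asymptotic: the infimum of the distances of their forward
orbits is positive, and in particular the distance does not tend to `0`. -/
theorem stmt_13 {X : Type*} [MetricSpace X] [CompleteSpace X] (F : X → X)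
    (hF : Continuous F) (C σ : ℝ) (hC : 0 < C) (hσ0 : 0 < σ) (hσ1 : σ < 1)
    (P : DyadicPieces F C σ) :
    ∀ w ∈ P.cantorSet, ∀ w' ∈ P.cantorSet, w ≠ w' →
      (0 < ⨅ k : ℕ, dist (F^[k] w) (F^[k] w')) ∧
      ¬ Filter.Tendsto (fun k : ℕ => dist (F^[k] w) (F^[k] w'))
          Filter.atTop (nhds 0) := by
  intro w hw w' hw' hne
  have hd : 0 < dist w w' := dist_pos.mpr hne
  obtain ⟨n, hn⟩ : ∃ n : ℕ, C * σ ^ (n + 1) < dist w w' := by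
    obtain ⟨n, hn⟩ := exists_pow_lt_of_lt_one (div_pos hd hC) hσ1
    refine ⟨n, ?_⟩
    have h1 : σ ^ (n + 1) ≤ σ ^ n := pow_le_pow_of_le_one hσ0.le hσ1.le (Nat.le_succ n)
    have h2 : σ ^ (n + 1) < dist w w' / C := lt_of_le_of_lt h1 hn
    rw [lt_div_iff₀ hC] at h2
    linarith
  obtain ⟨a, ha⟩ := Set.mem_iUnion.mp (Set.mem_iInter.mp hw n)
  obtain ⟨b, hb⟩ := Set.mem_iUnion.mp (Set.mem_iInter.mp hw' n)
  have hab : a ≠ b := by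
    rintro rfl
    have := Metric.dist_le_diam_of_mem (P.isCompact n a).isBounded ha hb
    have := P.diam_le n a
    linarith
  have hit : ∀ (x : X) (c : ZMod (2 ^ (n + 1))), x ∈ P.piece n c →
      ∀ k : ℕ, F^[k] x ∈ P.piece n (c + k) := by
    intro x c hx k
    induction k with
    | zero => simpa using hx
    | succ k ih =>
      rw [Function.iterate_succ_apply']
      have := P.mapsTo n _ ih
      rw [Nat.cast_succ, ← add_assoc]
      exact this
  haveI : NeZero (2 ^ (n + 1)) := ⟨by positivity⟩
  let K : Set (X × X) := ⋃ c : ZMod (2 ^ (n + 1)), P.piece n (a + c) ×ˢ P.piece n (b + c)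
  have hK : IsCompact K :=
    isCompact_iUnion fun c => (P.isCompact n _).prod (P.isCompact n _)
  have hmem : ∀ k : ℕ, (F^[k] w, F^[k] w') ∈ K := fun k =>
    Set.mem_iUnion.mpr ⟨(k : ZMod (2 ^ (n + 1))), hit w a ha k, hit w' b hb k⟩
  obtain ⟨p, hpK, hp⟩ := hK.exists_isMinOn ⟨_, hmem 0⟩
    (continuous_dist (α := X)).continuousOn
  have hpos : 0 < dist p.1 p.2 := by
    obtain ⟨c, hc1, hc2⟩ := Set.mem_iUnion.mp hpK
    refine dist_pos.mpr fun h => ?_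
    have hcc : a + c ≠ b + c := fun h => hab (add_right_cancel h)
    exact Set.disjoint_left.mp (P.disjoint n _ _ hcc) hc1 (h ▸ hc2)
  have hle : ∀ k : ℕ, dist p.1 p.2 ≤ dist (F^[k] w) (F^[k] w') := fun k => hp (hmem k)
  refine ⟨lt_of_lt_of_le hpos (le_ciInf hle), fun ht => ?_⟩
  exact absurd (ge_of_tendsto' ht hle) (not_le.mpr hpos)
end

section
/- Let F : X → X and F' : X' → X' be continuous maps on complete metric spaces carrying dyadic piece structures {B^n_a} and {B'^n_a} respectively (with constants C > 0, σ ∈ (0,1) and C' > 0, σ' ∈ (0,1)), and let O and O' be the corresponding critical Cantor sets. Let π : X → X' be a continuous map with π(B^n_a) = B'^n_a for every n ≥ 1 and every a ∈ ℤ/2ⁿℤ. Then the restriction of π to O is a homeomorphism from O onto O'. In particular, for a toy model Hénon-like map, the projection π_{xy} restricts to a bijection between the three-dimensional critical Cantor set and the critical Cantor set of the underlying two-dimensional Hénon-like map. -/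
/-- If `π` is a continuous map sending each piece of a dyadic piece
structure for `F` onto the corresponding piece of a dyadic piece structure for `F'`, then
`π` restricts to a homeomorphism (in particular, a bijection) from the critical Cantor set
of `F` onto that of `F'`. -/
theorem stmt_14 {X X' : Type*} [MetricSpace X] [CompleteSpace X]
    [MetricSpace X'] [CompleteSpace X']
    (F : X → X) (F' : X' → X') (hF : Continuous F) (hF' : Continuous F')
    (C σ C' σ' : ℝ) (hC : 0 < C) (hσ0 : 0 < σ) (hσ1 : σ < 1)
    (hC' : 0 < C') (hσ'0 : 0 < σ') (hσ'1 : σ' < 1)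
    (P : DyadicPieces F C σ) (P' : DyadicPieces F' C' σ')
    (π : X → X') (hπ : Continuous π)
    (hpieces : ∀ (n : ℕ) (a : ZMod (2 ^ (n + 1))), π '' P.piece n a = P'.piece n a) :
    Set.BijOn π P.cantorSet P'.cantorSet ∧
    ∃ e : P.cantorSet ≃ₜ P'.cantorSet, ∀ x : P.cantorSet, (e x : X') = π x := by
  have hinj : Set.InjOn π P.cantorSet := by
    intro x hx y hy hxy
    have hle : ∀ n : ℕ, dist x y ≤ C * σ ^ (n + 1) := by
      intro n
      obtain ⟨a, ha⟩ := Set.mem_iUnion.1 (Set.mem_iInter.1 hx n)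
      obtain ⟨b, hb⟩ := Set.mem_iUnion.1 (Set.mem_iInter.1 hy n)
      have ha' : π x ∈ P'.piece n a := hpieces n a ▸ Set.mem_image_of_mem π ha
      have hb' : π x ∈ P'.piece n b := hxy ▸ hpieces n b ▸ Set.mem_image_of_mem π hb
      have hab : a = b := by
        by_contra h
        exact Set.disjoint_left.1 (P'.disjoint n a b h) ha' hb'
      subst hab
      exact (Metric.dist_le_diam_of_mem (P.isCompact n a).isBounded ha hb).trans (P.diam_le n a)
    have hlim : Filter.Tendsto (fun n : ℕ => C * σ ^ (n + 1)) Filter.atTop (nhds 0) := by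
      have h := ((tendsto_pow_atTop_nhds_zero_of_lt_one hσ0.le hσ1).comp
        (Filter.tendsto_add_atTop_nat 1)).const_mul C
      simpa using h
    exact dist_le_zero.1 (ge_of_tendsto' hlim hle)
  have hmaps : Set.MapsTo π P.cantorSet P'.cantorSet := by
    intro x hx
    refine Set.mem_iInter.2 fun n => ?_
    obtain ⟨a, ha⟩ := Set.mem_iUnion.1 (Set.mem_iInter.1 hx n)
    exact Set.mem_iUnion.2 ⟨a, hpieces n a ▸ Set.mem_image_of_mem π ha⟩
  have hsurj : Set.SurjOn π P.cantorSet P'.cantorSet := by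
    intro y hy
    have hy' : ∀ n : ℕ, ∃ a, y ∈ P'.piece n a := fun n =>
      Set.mem_iUnion.1 (Set.mem_iInter.1 hy n)
    choose a ha using hy'
    have hcl : IsClosed (π ⁻¹' {y}) := isClosed_singleton.preimage hπ
    have hK : ∀ n, IsCompact (P.piece n (a n) ∩ π ⁻¹' {y}) := fun n =>
      (P.isCompact n (a n)).inter_right hcl
    obtain ⟨x, hx⟩ := IsCompact.nonempty_iInter_of_sequence_nonempty_isCompact_isClosed
      (fun n => P.piece n (a n) ∩ π ⁻¹' {y})
      (by
        intro n
        refine Set.inter_subset_inter_left _ ?_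
        have h := P'.nested n (a (n + 1)) (ha (n + 1))
        have heq : ZMod.castHom (pow_dvd_pow 2 (Nat.le_succ (n + 1))) (ZMod (2 ^ (n + 1)))
            (a (n + 1)) = a n := by
          by_contra hne
          exact Set.disjoint_left.1 (P'.disjoint n _ _ hne) h (ha n)
        have h2 := P.nested n (a (n + 1))
        rw [heq] at h2
        exact h2)
      (by
        intro n
        have h := ha n
        rw [← hpieces] at h
        obtain ⟨x, hx, hxy⟩ := h
        exact ⟨x, hx, hxy⟩)
      (hK 0) (fun n => (hK n).isClosed)
    have hx' := Set.mem_iInter.1 hx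
    exact ⟨x, Set.mem_iInter.2 fun n => Set.mem_iUnion.2 ⟨a n, (hx' n).1⟩, (hx' 0).2⟩
  have hbij : Set.BijOn π P.cantorSet P'.cantorSet := ⟨hmaps, hinj, hsurj⟩
  refine ⟨hbij, ?_⟩
  have hlev : ∀ n : ℕ, IsCompact (⋃ a : ZMod (2 ^ (n + 1)), P.piece n a) := by
    intro n
    haveI : NeZero (2 ^ (n + 1)) := ⟨by positivity⟩
    exact isCompact_iUnion (P.isCompact n)
  have hcpt : IsCompact P.cantorSet :=
    (hlev 0).of_isClosed_subset (isClosed_iInter fun n => (hlev n).isClosed)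
      (Set.iInter_subset _ 0)
  haveI : CompactSpace P.cantorSet := isCompact_iff_compactSpace.1 hcpt
  have hcont : Continuous (hbij.equiv π) :=
    Continuous.subtype_mk (hπ.comp continuous_subtype_val) _
  exact ⟨hcont.homeoOfEquivCompactToT2, fun x => rfl⟩
end
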